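/- The function I₀ is twice differentiable on (0, ∞) and satisfies, for every real s > 0, the linear non-homogeneous second-order differential equation 16s(1 + s)·I₀''(s) + 16(1 + 2s)·I₀'(s) + 3·I₀(s) = -2/√(1 + s). -/

import Mathlib

open Real

/-- `I_ν(s) = (1/√2) ∫₋₁¹ tᵛ/(√(t+1)√(t²+s)) dt`. -/
noncomputable def Inu (ν : ℕ) (s : ℝ) : ℝ :=
  (1 / Real.sqrt 2) * ∫ t in (-1 : ℝ)..1, t ^ ν / (Real.sqrt (t + 1) * Real.sqrt (t ^ 2 + s))

lemma intervalIntegrable_inv_sqrt_add_one :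
    IntervalIntegrable (fun t : ℝ => (√(t + 1))⁻¹) MeasureTheory.volume (-1) 1 := by
  have h := (intervalIntegral.intervalIntegrable_rpow' (a := 0) (b := 2) (r := -(1 / 2))
    (by norm_num)).comp_add_right 1
  norm_num at h
  refine h.congr fun t ht => ?_
  rw [Set.uIoc_of_le (by norm_num)] at ht
  rw [Real.sqrt_eq_rpow, ← Real.rpow_neg (by linarith [ht.1])]

lemma continuous_sq_add_rpow (p : ℝ) {s : ℝ} (hs : 0 < s) :
    Continuous fun t : ℝ => (t ^ 2 + s) ^ p :=
  (by fun_prop : Continuous fun t : ℝ => t ^ 2 + s).rpow_const fun t => Or.inl (by positivity)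

lemma intervalIntegrable_inv_sqrt_mul_rpow (p : ℝ) {s : ℝ} (hs : 0 < s) :
    IntervalIntegrable (fun t : ℝ => (√(t + 1))⁻¹ * (t ^ 2 + s) ^ p)
      MeasureTheory.volume (-1) 1 :=
  intervalIntegrable_inv_sqrt_add_one.mul_continuousOn (continuous_sq_add_rpow p hs).continuousOn

lemma hasDerivAt_integral_inv_sqrt_mul_rpow {p : ℝ} (hp : p ≤ 1) {s : ℝ} (hs : 0 < s) :
    HasDerivAt (fun s : ℝ => ∫ t in (-1 : ℝ)..1, (√(t + 1))⁻¹ * (t ^ 2 + s) ^ p)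
      (p * ∫ t in (-1 : ℝ)..1, (√(t + 1))⁻¹ * (t ^ 2 + s) ^ (p - 1)) s := by
  rw [← intervalIntegral.integral_const_mul]
  refine (intervalIntegral.hasDerivAt_integral_of_dominated_loc_of_deriv_le
    (F := fun s t : ℝ => (√(t + 1))⁻¹ * (t ^ 2 + s) ^ p)
    (F' := fun s t : ℝ => p * ((√(t + 1))⁻¹ * (t ^ 2 + s) ^ (p - 1)))
    (bound := fun t : ℝ => |p| * ((√(t + 1))⁻¹ * (s / 2) ^ (p - 1)))
    (Ioi_mem_nhds (half_lt_self hs)) ?_ (intervalIntegrable_inv_sqrt_mul_rpow p hs) ?_ ?_ ?_ ?_).2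
  · filter_upwards [Ioi_mem_nhds hs] with x hx
    exact (intervalIntegrable_inv_sqrt_mul_rpow p hx).def'.aestronglyMeasurable
  · exact ((intervalIntegrable_inv_sqrt_mul_rpow (p - 1) hs).const_mul p).def'.aestronglyMeasurable
  · refine .of_forall fun t _ x hx => ?_
    have hx' : s / 2 < x := hx
    have hx0 : 0 < x := by linarith
    rw [Real.norm_eq_abs, abs_mul, abs_of_nonneg (a := (√(t + 1))⁻¹ * _) (by positivity)]
    gcongr _ * (_ * ?_)
    exact Real.rpow_le_rpow_of_nonpos (by positivity) (by nlinarith [sq_nonneg t]) (by linarith)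
  · exact (intervalIntegrable_inv_sqrt_add_one.mul_const _).const_mul _
  · refine .of_forall fun t _ x hx => ?_
    have hx' : s / 2 < x := hx
    have hx0 : 0 < x := by linarith
    exact ((((hasDerivAt_id' x).const_add (t ^ 2)).rpow_const (p := p)
      (Or.inl (by positivity))).const_mul (√(t + 1))⁻¹).congr_deriv (by ring)

lemma Inu_zero_eq {s : ℝ} (hs : 0 < s) :
    Inu 0 s =
      (1 / √2) * ∫ t in (-1 : ℝ)..1, (√(t + 1))⁻¹ * (t ^ 2 + s) ^ (-(1 / 2) : ℝ) := by
  unfold Inu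
  congr 2
  ext t
  rw [Real.rpow_neg (by positivity), ← Real.sqrt_eq_rpow, pow_zero, one_div, mul_inv]

lemma hasDerivAt_Inu_zero {s : ℝ} (hs : 0 < s) :
    HasDerivAt (Inu 0) ((1 / √2) * (-(1 / 2) *
      ∫ t in (-1 : ℝ)..1, (√(t + 1))⁻¹ * (t ^ 2 + s) ^ (-(1 / 2) - 1 : ℝ))) s :=
  ((hasDerivAt_integral_inv_sqrt_mul_rpow (by norm_num) hs).const_mul _).congr_of_eventuallyEq
    ((eventually_gt_nhds hs).mono fun _ hx => Inu_zero_eq hx)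

lemma hasDerivAt_deriv_Inu_zero {s : ℝ} (hs : 0 < s) :
    HasDerivAt (deriv (Inu 0)) ((1 / √2) * (-(1 / 2) * ((-(1 / 2) - 1) *
      ∫ t in (-1 : ℝ)..1, (√(t + 1))⁻¹ * (t ^ 2 + s) ^ (-(1 / 2) - 1 - 1 : ℝ)))) s :=
  (((hasDerivAt_integral_inv_sqrt_mul_rpow (by norm_num) hs).const_mul _).const_mul
    _).congr_of_eventuallyEq
    ((eventually_gt_nhds hs).mono fun _ hx => (hasDerivAt_Inu_zero hx).deriv)

/-- The differential operator applied to the integrand of `I₀` is an exact `t`-derivative. -/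
lemma hasDerivAt_primitive {s t : ℝ} (hs : 0 < s) (ht : -1 < t) :
    HasDerivAt
      (fun t : ℝ => √(t + 1) * (-6 * t ^ 2 + 4 * t - 2 * s) * (t ^ 2 + s) ^ (-(1 / 2) - 1 : ℝ))
      (12 * s * (1 + s) * ((√(t + 1))⁻¹ * (t ^ 2 + s) ^ (-(1 / 2) - 1 - 1 : ℝ))
        - 8 * (1 + 2 * s) * ((√(t + 1))⁻¹ * (t ^ 2 + s) ^ (-(1 / 2) - 1 : ℝ))
        + 3 * ((√(t + 1))⁻¹ * (t ^ 2 + s) ^ (-(1 / 2) : ℝ))) t := by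
  have h1 : 0 < t + 1 := by linarith
  have h2 : 0 < t ^ 2 + s := by positivity
  have hsqrt := ((hasDerivAt_id' t).add_const 1).sqrt h1.ne'
  have hpoly := ((((hasDerivAt_id' t).pow 2).const_mul (-6)).add
    ((hasDerivAt_id' t).const_mul 4)).sub_const (2 * s)
  have hpow := (((hasDerivAt_id' t).pow 2).add_const s).rpow_const
    (p := (-(1 / 2) - 1 : ℝ)) (Or.inl h2.ne')
  refine ((hsqrt.mul hpoly).mul hpow).congr_deriv ?_
  have e1 : (t ^ 2 + s) ^ (-(1 / 2) - 1 : ℝ) =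
      (t ^ 2 + s) ^ (-(1 / 2) - 1 - 1 : ℝ) * (t ^ 2 + s) := by
    rw [← Real.rpow_add_one h2.ne']; norm_num
  have e2 : (t ^ 2 + s) ^ (-(1 / 2) : ℝ) =
      (t ^ 2 + s) ^ (-(1 / 2) - 1 - 1 : ℝ) * (t ^ 2 + s) * (t ^ 2 + s) := by
    rw [← e1, ← Real.rpow_add_one h2.ne']; norm_num
  simp only [Pi.mul_apply, Pi.add_apply, Pi.pow_apply]
  rw [e2, e1]
  generalize (t ^ 2 + s) ^ (-(1 / 2) - 1 - 1 : ℝ) = w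
  have h3 : 0 < √(t + 1) := Real.sqrt_pos.2 h1
  have h4 : √(t + 1) ^ 2 = t + 1 := Real.sq_sqrt h1.le
  generalize √(t + 1) = u at *
  obtain rfl : t = u ^ 2 - 1 := by linarith
  field_simp
  ring

/-- `I₀` is twice differentiable on `(0,∞)` and satisfies there
`16s(1+s) I₀'' + 16(1+2s) I₀' + 3 I₀ = -2/√(1+s)`. -/
theorem stmt15 :
    (∀ s ∈ Set.Ioi (0 : ℝ),
        DifferentiableAt ℝ (Inu 0) s ∧ DifferentiableAt ℝ (deriv (Inu 0)) s) ∧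
    ∀ s ∈ Set.Ioi (0 : ℝ),
      16 * s * (1 + s) * deriv (deriv (Inu 0)) s +
          16 * (1 + 2 * s) * deriv (Inu 0) s + 3 * Inu 0 s =
        -2 / Real.sqrt (1 + s) := by
  refine ⟨fun s hs => ⟨(hasDerivAt_Inu_zero hs).differentiableAt,
    (hasDerivAt_deriv_Inu_zero hs).differentiableAt⟩, fun s hs => ?_⟩
  have hs0 : 0 < s := hs
  have i0 := (intervalIntegrable_inv_sqrt_mul_rpow (-(1 / 2)) hs0).const_mul 3
  have i1 := (intervalIntegrable_inv_sqrt_mul_rpow (-(1 / 2) - 1) hs0).const_mul (8 * (1 + 2 * s))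
  have i2 := (intervalIntegrable_inv_sqrt_mul_rpow (-(1 / 2) - 1 - 1) hs0).const_mul
    (12 * s * (1 + s))
  have key := intervalIntegral.integral_eq_sub_of_hasDerivAt_of_le (by norm_num)
    (Continuous.continuousOn <|
      (by fun_prop : Continuous fun t : ℝ => √(t + 1) * (-6 * t ^ 2 + 4 * t - 2 * s)).mul
        (continuous_sq_add_rpow (-(1 / 2) - 1) hs0))
    (fun t ht => hasDerivAt_primitive hs0 ht.1) ((i2.sub i1).add i0)
  rw [intervalIntegral.integral_add (i2.sub i1) i0, intervalIntegral.integral_sub i2 i1] at key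
  simp only [intervalIntegral.integral_const_mul, Pi.mul_apply] at key
  have hval : ((1 : ℝ) ^ 2 + s) ^ (-(1 / 2) - 1 : ℝ) = (√(1 + s))⁻¹ / (1 + s) := by
    rw [one_pow, Real.rpow_sub_one (by positivity), Real.rpow_neg (by positivity),
      ← Real.sqrt_eq_rpow]
  rw [hval, show (1 : ℝ) + 1 = 2 by norm_num, show (-1 : ℝ) + 1 = 0 by norm_num,
    Real.sqrt_zero] at key
  rw [(hasDerivAt_deriv_Inu_zero hs0).deriv, (hasDerivAt_Inu_zero hs0).deriv, Inu_zero_eq hs0]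
  have hroot : √(1 + s) ≠ 0 := by positivity
  calc _ = (1 / √2) * (√2 * (-6 * 1 ^ 2 + 4 * 1 - 2 * s) * ((√(1 + s))⁻¹ / (1 + s)) - 0) := by
        linear_combination (1 / √2) * key
    _ = _ := by
        field_simp
        ring
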